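/- For every integer n ≥ 1, the identity q^{−n} ∑_{j=0}^{n} q^{j²+j} ([n−1 choose j]_q [n+1 choose j+1]_q − [n choose j]_q [n choose j+1]_q) t^j = (1/[n]) ∑_{j=0}^{n−1} q^{j²+j} [n choose j]_q [n choose j+1]_q t^j holds in ℚ(q)[t]. -/

import Mathlib

open Finset Polynomial

/-- The field `ℚ(q)` of rational functions. -/
noncomputable abbrev K : Type := RatFunc ℚ

/-- The indeterminate `q`, viewed in `ℚ(q)`. -/
noncomputable def q : K := RatFunc.X

/-- `[n] = (1 - q^n)/(1 - q)` in `ℚ(q)`. -/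
noncomputable def qint (n : ℕ) : K := (1 - q ^ n) / (1 - q)

/-- The Gaussian binomial coefficient `[n choose k]_q` in `ℚ(q)`. -/
noncomputable def qbinom (n k : ℤ) : K :=
  if 0 ≤ k ∧ k ≤ n then
    ∏ i ∈ Finset.range k.toNat, (1 - q ^ (n - k + (i : ℤ) + 1)) / (1 - q ^ ((i : ℤ) + 1))
  else if k = 0 then 1 else 0

theorem one_sub_q_pow_ne_zero (k : ℕ) : (1 : K) - q ^ (k + 1) ≠ 0 := by
  intro h
  have hX : (Polynomial.X : ℚ[X]) ^ (k + 1) = 1 := by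
    apply RatFunc.algebraMap_injective ℚ
    rw [map_pow, RatFunc.algebraMap_X, map_one]
    exact (sub_eq_zero.mp h).symm
  simpa using congrArg Polynomial.natDegree hX

theorem q_ne_zero : q ≠ 0 := RatFunc.X_ne_zero

theorem qbinom_add_self (m k : ℕ) :
    qbinom ((m : ℤ) + k) k =
      ∏ i ∈ Finset.range k, (1 - q ^ (m + i + 1)) / (1 - q ^ (i + 1)) := by
  rw [qbinom, if_pos (by omega), Int.toNat_natCast]
  refine Finset.prod_congr rfl fun i _ => ?_
  rw [add_sub_cancel_right]
  norm_cast

theorem qbinom_eq_zero_of_lt {n k : ℤ} (hk : k ≠ 0) (h : n < k) : qbinom n k = 0 := by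
  rw [qbinom, if_neg (by omega), if_neg hk]

theorem qbinom_succ_add_self_mul (m k : ℕ) :
    qbinom ((m : ℤ) + 1 + k) k * (1 - q ^ (m + 1)) =
      qbinom ((m : ℤ) + k) k * (1 - q ^ (m + k + 1)) := by
  rw [← Nat.cast_succ, qbinom_add_self, qbinom_add_self]
  induction k with
  | zero => simp
  | succ k ih =>
    rw [Finset.prod_range_succ, Finset.prod_range_succ, mul_right_comm, ih,
      show m.succ + k + 1 = m + (k + 1) + 1 by omega]
    ring

/-- The coefficientwise form of the identity, with `n = m + j + 1`. -/
theorem qbinom_mul_qbinom_sub (m j : ℕ) :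
    q ^ (-((m + j + 1 : ℕ) : ℤ)) *
      (qbinom (((m + j + 1 : ℕ) : ℤ) - 1) j *
          qbinom (((m + j + 1 : ℕ) : ℤ) + 1) ((j : ℤ) + 1) -
        qbinom ((m + j + 1 : ℕ) : ℤ) j * qbinom ((m + j + 1 : ℕ) : ℤ) ((j : ℤ) + 1)) =
    (qint (m + j + 1))⁻¹ *
      (qbinom ((m + j + 1 : ℕ) : ℤ) j * qbinom ((m + j + 1 : ℕ) : ℤ) ((j : ℤ) + 1)) := by
  have hA := qbinom_succ_add_self_mul m j
  have hB := qbinom_succ_add_self_mul m (j + 1)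
  rw [show ((m + j + 1 : ℕ) : ℤ) - 1 = (m : ℤ) + j by push_cast; ring,
    show ((m + j + 1 : ℕ) : ℤ) + 1 = (m : ℤ) + 1 + (j + 1 : ℕ) by push_cast; ring,
    show qbinom ((m + j + 1 : ℕ) : ℤ) j = qbinom ((m : ℤ) + 1 + j) j by
      congr 1; push_cast; ring,
    show qbinom ((m + j + 1 : ℕ) : ℤ) ((j : ℤ) + 1) =
        qbinom ((m : ℤ) + (j + 1 : ℕ)) (j + 1 : ℕ) by congr 1,
    ← Nat.cast_succ j, Nat.succ_eq_add_one]
  have hm := one_sub_q_pow_ne_zero m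
  have hn := one_sub_q_pow_ne_zero (m + j)
  have h1 : (1 : K) - q ≠ 0 := by simpa using one_sub_q_pow_ne_zero 0
  have hq : q ^ (m + j + 1) ≠ 0 := pow_ne_zero _ q_ne_zero
  rw [show q ^ (m + (j + 1) + 1) = q ^ (m + j + 1) * q by ring] at hB
  rw [zpow_neg, zpow_natCast, qint, inv_div]
  generalize q ^ (m + j + 1) = Q at *
  rw [← eq_div_iff hm] at hA hB
  rw [hA, hB]
  field_simp
  ring

/-- In `ℚ(q)[t]`, for `n ≥ 1`:
`q^{−n} ∑_{j=0}^{n} q^{j²+j} ([n−1 choose j][n+1 choose j+1] − [n choose j][n choose j+1]) t^j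
 = (1/[n]) ∑_{j=0}^{n−1} q^{j²+j} [n choose j][n choose j+1] t^j`. -/
theorem coeffA_eq_qNarayana (n : ℕ) (hn : 1 ≤ n) :
    (q ^ (-(n : ℤ))) •
      ∑ j ∈ Finset.range (n + 1),
        Polynomial.C (q ^ (j ^ 2 + j) *
          (qbinom ((n : ℤ) - 1) j * qbinom ((n : ℤ) + 1) ((j : ℤ) + 1) -
           qbinom n j * qbinom n ((j : ℤ) + 1))) * Polynomial.X ^ j =
    (qint n)⁻¹ •
      ∑ j ∈ Finset.range n,
        Polynomial.C (q ^ (j ^ 2 + j) * qbinom n j * qbinom n ((j : ℤ) + 1)) *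
          Polynomial.X ^ j := by
  rw [Finset.sum_range_succ, qbinom_eq_zero_of_lt (n := (n : ℤ) - 1) (by omega) (by omega),
    qbinom_eq_zero_of_lt (n := (n : ℤ)) (k := (n : ℤ) + 1) (by omega) (by omega)]
  simp only [zero_mul, mul_zero, sub_zero, map_zero, add_zero]
  rw [Finset.smul_sum, Finset.smul_sum]
  refine Finset.sum_congr rfl fun j hj => ?_
  obtain ⟨m, rfl⟩ : ∃ m, n = m + j + 1 :=
    ⟨n - 1 - j, by have := Finset.mem_range.mp hj; omega⟩
  rw [← smul_mul_assoc, ← smul_mul_assoc, Polynomial.smul_C, Polynomial.smul_C, smul_eq_mul,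
    smul_eq_mul, mul_left_comm, qbinom_mul_qbinom_sub]
  congr 2
  ring
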